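/- arXiv:2210.11104 — 2 statements merged into one kernel-verified Lean document; each statement's English description precedes it below -/
import Mathlib

section
/- Let X_1 and ε_2 be independent square-integrable random variables with mean zero and positive variance, let β ≠ 0, suppose that βX_1 and ε_2 have the same distribution, and let X_2 = βX_1 + ε_2. Then E[(X_1 − E[X_1 | X_2])²] · Var(X_2) = Var(X_1) · Var(ε_2); that is, the product of residual variances in the anti-causal direction equals the product of variances in the causal direction, so the Gaussian-likelihood score gap Δ is zero. -/
open MeasureTheory ProbabilityTheory

/-- If `(Y, Z)` is exchangeable, the conditional expectation of `Y` given `Y + Z` is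
`(Y + Z) / 2`. -/
theorem condExp_comap_add_of_identDistrib_swap
    {Ω : Type*} [mΩ : MeasurableSpace Ω] {μ : Measure Ω} [IsFiniteMeasure μ] {Y Z : Ω → ℝ}
    (hY : Measurable Y) (hZ : Measurable Z) (hYi : Integrable Y μ) (hZi : Integrable Z μ)
    (hswap : IdentDistrib (fun ω => (Y ω, Z ω)) (fun ω => (Z ω, Y ω)) μ μ) :
    μ[Y | MeasurableSpace.comap (fun ω => Y ω + Z ω) Real.measurableSpace]
      =ᵐ[μ] fun ω => (Y ω + Z ω) / 2 := by
  have hm : MeasurableSpace.comap (fun ω => Y ω + Z ω) Real.measurableSpace ≤ mΩ :=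
    (hY.add hZ).comap_le
  symm
  refine ae_eq_condExp_of_forall_setIntegral_eq hm hYi
    (fun _ _ _ => ((hYi.add hZi).div_const 2).integrableOn) ?_ ?_
  · rintro _ ⟨B, hB, rfl⟩ -
    have hS : MeasurableSet ((fun ω => Y ω + Z ω) ⁻¹' B) := (hY.add hZ) hB
    have hBpre : MeasurableSet {p : ℝ × ℝ | p.1 + p.2 ∈ B} :=
      (measurable_fst.add measurable_snd) hB
    have hYZ : ∫ ω in (fun ω => Y ω + Z ω) ⁻¹' B, Y ω ∂μ
        = ∫ ω in (fun ω => Y ω + Z ω) ⁻¹' B, Z ω ∂μ := by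
      have h := (hswap.comp (measurable_fst.indicator hBpre)).integral_eq
      rw [← integral_indicator hS, ← integral_indicator hS]
      convert h using 3 with ω ω
      · rfl
      · have hmem : (fun ω => Y ω + Z ω) ω ∈ B ↔ Z ω + Y ω ∈ B := by rw [add_comm]
        classical exact if_congr hmem rfl rfl
    rw [integral_div, integral_add hYi.integrableOn hZi.integrableOn, ← hYZ]
    ring
  · exact ((comap_measurable (fun ω => Y ω + Z ω)).div_const 2).aestronglyMeasurable

/-- If `X₁` and `ε₂` are independent square-integrable centered random variables with
positive variance, `β ≠ 0`, `β X₁` has the same distribution as `ε₂`, and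
`X₂ = β X₁ + ε₂`, then `E[(X₁ − E[X₁ | X₂])²] · Var(X₂) = Var(X₁) · Var(ε₂)`:
the Gaussian-likelihood score gap `Δ` is zero. -/
theorem gap_zero_of_eq_distrib
    {Ω : Type*} [MeasurableSpace Ω] (μ : Measure Ω) [IsProbabilityMeasure μ]
    (X₁ ε₂ : Ω → ℝ) (hX₁ : Measurable X₁) (hε₂ : Measurable ε₂)
    (hL2₁ : MemLp X₁ 2 μ) (hL2₂ : MemLp ε₂ 2 μ)
    (hmean₁ : ∫ ω, X₁ ω ∂μ = 0) (hmean₂ : ∫ ω, ε₂ ω ∂μ = 0)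
    (hvar₁ : 0 < variance X₁ μ) (hvar₂ : 0 < variance ε₂ μ)
    (hindep : IndepFun X₁ ε₂ μ)
    (β : ℝ) (hβ : β ≠ 0)
    (hdist : Measure.map (fun ω => β * X₁ ω) μ = Measure.map ε₂ μ)
    (X₂ : Ω → ℝ) (hX₂ : X₂ = fun ω => β * X₁ ω + ε₂ ω) :
    (∫ ω, (X₁ ω - (μ[X₁ | MeasurableSpace.comap X₂ Real.measurableSpace]) ω) ^ 2 ∂μ) *
        variance X₂ μ = variance X₁ μ * variance ε₂ μ := by
  subst hX₂
  have hY : Measurable fun ω => β * X₁ ω := hX₁.const_mul β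
  have hYL : MemLp (fun ω => β * X₁ ω) 2 μ := hL2₁.const_mul β
  have hYi : Integrable (fun ω => β * X₁ ω) μ := hYL.integrable one_le_two
  have hYind : IndepFun (fun ω => β * X₁ ω) ε₂ μ :=
    hindep.comp (measurable_const_mul β) measurable_id
  have hid : IdentDistrib (fun ω => β * X₁ ω) ε₂ μ μ :=
    ⟨hY.aemeasurable, hε₂.aemeasurable, hdist⟩
  have hswap : IdentDistrib (fun ω => (β * X₁ ω, ε₂ ω)) (fun ω => (ε₂ ω, β * X₁ ω)) μ μ :=
    hid.prodMk hid.symm hYind hYind.symm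
  have hcond : μ[X₁ | MeasurableSpace.comap (fun ω => β * X₁ ω + ε₂ ω) Real.measurableSpace]
      =ᵐ[μ] fun ω => (β * X₁ ω + ε₂ ω) / (2 * β) := by
    filter_upwards [condExp_comap_add_of_identDistrib_swap hY hε₂ hYi
      (hL2₂.integrable one_le_two) hswap, condExp_smul β X₁
      (MeasurableSpace.comap (fun ω => β * X₁ ω + ε₂ ω) Real.measurableSpace) (μ := μ)]
      with ω h₁ h₂
    have h : β * (μ[X₁ | MeasurableSpace.comap (fun ω => β * X₁ ω + ε₂ ω)
        Real.measurableSpace]) ω = (β * X₁ ω + ε₂ ω) / 2 := h₂.symm.trans h₁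
    field_simp
    linarith
  have hvar_eq : variance ε₂ μ = β ^ 2 * variance X₁ μ := by
    rw [← hid.variance_eq, variance_const_mul]
  have hvar_add : variance (fun ω => β * X₁ ω + ε₂ ω) μ = 2 * variance ε₂ μ := by
    rw [hYind.variance_fun_add hYL hL2₂, hid.variance_eq]
    ring
  have hvar_sub : ∫ ω, (β * X₁ ω - ε₂ ω) ^ 2 ∂μ = 2 * variance ε₂ μ := by
    have hmean : ∫ ω, (β * X₁ ω - ε₂ ω) ∂μ = 0 := by
      rw [integral_sub hYi (hL2₂.integrable one_le_two), integral_const_mul, hmean₁, hmean₂]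
      ring
    rw [← variance_of_integral_eq_zero (by fun_prop) hmean,
      variance_fun_sub hYL hL2₂, hYind.covariance_eq_zero hYL hL2₂, hid.variance_eq]
    ring
  have hres : ∫ ω, (X₁ ω - (μ[X₁ | MeasurableSpace.comap (fun ω => β * X₁ ω + ε₂ ω)
      Real.measurableSpace]) ω) ^ 2 ∂μ = 2 * variance ε₂ μ / (2 * β) ^ 2 := by
    rw [← hvar_sub, ← integral_div]
    refine integral_congr_ae ?_
    filter_upwards [hcond] with ω h
    rw [h]
    field_simp
    ring
  rw [hres, hvar_add, hvar_eq]
  field_simp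
end

section
/- Let X_1 be a square-integrable random variable that is symmetric about zero, let f : ℝ → ℝ be a measurable even function with f(X_1) square-integrable and Var(f(X_1)) > 0, let ε_2 be a square-integrable random variable independent of X_1 with E[ε_2] = 0 and Var(ε_2) > 0, and let X_2 = f(X_1) + ε_2. Then E[(X_1 − E[X_1 | X_2])²] = Var(X_1), and consequently (E[(X_1 − E[X_1|X_2])²] · Var(X_2)) / (Var(X_1) · Var(ε_2)) = Var(X_2)/Var(ε_2) > 1; that is, the Gaussian-likelihood gap condition Δ > 0 holds regardless of the distribution of ε_2. -/
open MeasureTheory ProbabilityTheory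

/-- If `X` is symmetric about zero and independent of `Y`, then `(X, Y)` and `(-X, Y)` have the
same law. -/
theorem identDistrib_prodMk_neg_left
    {Ω : Type*} [MeasurableSpace Ω] {μ : Measure Ω} [IsProbabilityMeasure μ]
    {X Y : Ω → ℝ} (hX : Measurable X) (hY : Measurable Y)
    (hsymm : μ.map X = μ.map (fun ω => -X ω)) (hindep : IndepFun X Y μ) :
    IdentDistrib (fun ω => (X ω, Y ω)) (fun ω => (-X ω, Y ω)) μ μ where
  aemeasurable_fst := (hX.prodMk hY).aemeasurable
  aemeasurable_snd := (hX.neg.prodMk hY).aemeasurable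
  map_eq := by
    have hindep_neg : IndepFun (fun ω => -X ω) Y μ :=
      hindep.comp measurable_neg measurable_id
    rw [(indepFun_iff_map_prod_eq_prod_map_map hX.aemeasurable hY.aemeasurable).1 hindep,
      (indepFun_iff_map_prod_eq_prod_map_map hX.fun_neg.aemeasurable hY.aemeasurable).1 hindep_neg,
      hsymm]

/-- If `(X, Y)` and `(-X, Y)` have the same law and `g` is even in its first argument, then
`E[X | g(X, Y)] = 0`. -/
theorem condExp_comap_ae_eq_zero_of_even
    {Ω : Type*} [MeasurableSpace Ω] {μ : Measure Ω} [IsProbabilityMeasure μ]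
    {X Y Z : Ω → ℝ} {g : ℝ × ℝ → ℝ} (hint : Integrable X μ)
    (hlaw : IdentDistrib (fun ω => (X ω, Y ω)) (fun ω => (-X ω, Y ω)) μ μ)
    (hg : Measurable g) (heven : ∀ x y, g (-x, y) = g (x, y))
    (hZ : Measurable Z) (hZg : ∀ ω, Z ω = g (X ω, Y ω)) :
    μ[X | MeasurableSpace.comap Z Real.measurableSpace] =ᵐ[μ] 0 := by
  symm
  refine ae_eq_condExp_of_forall_setIntegral_eq hZ.comap_le hint
    (fun _ _ _ => integrableOn_zero) ?_ aestronglyMeasurable_zero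
  rintro _ ⟨t, ht, rfl⟩ -
  have hind : Measurable ((g ⁻¹' t).indicator Prod.fst) :=
    measurable_fst.indicator (hg ht)
  have hodd : ∀ x y, (g ⁻¹' t).indicator Prod.fst (-x, y) =
      -(g ⁻¹' t).indicator Prod.fst (x, y) := by
    intro x y
    by_cases h : g (x, y) ∈ t <;> simp [Set.indicator, heven, h]
  have heq : ∫ ω in Z ⁻¹' t, X ω ∂μ = ∫ ω, (g ⁻¹' t).indicator Prod.fst (X ω, Y ω) ∂μ := by
    rw [← integral_indicator (hZ ht)]
    congr 1 with ω
    by_cases h : g (X ω, Y ω) ∈ t <;> simp [hZg, h]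
  have hneg := (hlaw.comp hind).integral_eq
  simp only [Function.comp_apply, hodd, integral_neg] at hneg
  rw [heq]
  simp only [Pi.zero_apply, integral_zero]
  linarith

/-- A random variable with a nondegenerate image is itself nondegenerate. -/
theorem variance_pos_of_variance_comp_pos
    {Ω : Type*} [MeasurableSpace Ω] {μ : Measure Ω} [IsProbabilityMeasure μ]
    {X : Ω → ℝ} {f : ℝ → ℝ} (hX : MemLp X 2 μ)
    (hf : 0 < variance (fun ω => f (X ω)) μ) : 0 < variance X μ := by
  refine (variance_nonneg X μ).lt_of_ne' fun h => hf.ne' ?_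
  have hconst : (fun ω => f (X ω)) =ᵐ[μ] fun _ => f (∫ ω, X ω ∂μ) := by
    filter_upwards [ae_eq_integral_of_variance_eq_zero hX h] with ω hω
    rw [hω]
  rw [variance_congr hconst, variance_eq_integral aemeasurable_const]
  simp

/-- If `X₁` is square-integrable and symmetric about zero, `f` is a measurable even
function with `f(X₁)` square-integrable and `Var(f(X₁)) > 0`, `ε₂` is
square-integrable, independent of `X₁`, with mean zero and positive variance, and
`X₂ = f(X₁) + ε₂`, then `E[(X₁ − E[X₁ | X₂])²] = Var(X₁)` and consequently the ratio
`(E[(X₁ − E[X₁|X₂])²] · Var(X₂)) / (Var(X₁) · Var(ε₂))` equals `Var(X₂)/Var(ε₂) > 1`,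
so the Gaussian-likelihood gap condition `Δ > 0` holds. -/
theorem gap_positive_of_even
    {Ω : Type*} [MeasurableSpace Ω] (μ : Measure Ω) [IsProbabilityMeasure μ]
    (X₁ ε₂ : Ω → ℝ) (hX₁ : Measurable X₁) (hε₂ : Measurable ε₂)
    (hL2₁ : MemLp X₁ 2 μ)
    (hsymm : Measure.map X₁ μ = Measure.map (fun ω => -X₁ ω) μ)
    (f : ℝ → ℝ) (hf : Measurable f) (heven : ∀ x : ℝ, f (-x) = f x)
    (hL2f : MemLp (fun ω => f (X₁ ω)) 2 μ)
    (hvarf : 0 < variance (fun ω => f (X₁ ω)) μ)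
    (hL2₂ : MemLp ε₂ 2 μ) (hmean₂ : ∫ ω, ε₂ ω ∂μ = 0)
    (hvar₂ : 0 < variance ε₂ μ)
    (hindep : IndepFun X₁ ε₂ μ)
    (X₂ : Ω → ℝ) (hX₂ : X₂ = fun ω => f (X₁ ω) + ε₂ ω) :
    (∫ ω, (X₁ ω - (μ[X₁ | MeasurableSpace.comap X₂ Real.measurableSpace]) ω) ^ 2 ∂μ) =
        variance X₁ μ ∧
    (∫ ω, (X₁ ω - (μ[X₁ | MeasurableSpace.comap X₂ Real.measurableSpace]) ω) ^ 2 ∂μ) *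
          variance X₂ μ / (variance X₁ μ * variance ε₂ μ) =
        variance X₂ μ / variance ε₂ μ ∧
    1 < variance X₂ μ / variance ε₂ μ := by
  have hX₂_meas : Measurable X₂ := hX₂ ▸ (hf.comp hX₁).add hε₂
  have hmean₁ : ∫ ω, X₁ ω ∂μ = 0 := by
    have h : IdentDistrib X₁ (fun ω => -X₁ ω) μ μ :=
      ⟨hX₁.aemeasurable, hX₁.neg.aemeasurable, hsymm⟩
    have := h.integral_eq
    rw [integral_neg] at this
    linarith
  have hcond := condExp_comap_ae_eq_zero_of_even (g := fun p => f p.1 + p.2) (Z := X₂)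
    (hL2₁.integrable one_le_two) (identDistrib_prodMk_neg_left hX₁ hε₂ hsymm hindep)
    (by fun_prop) (fun x y => by simp [heven]) hX₂_meas (fun ω => by simp [hX₂])
  have hmse : (∫ ω, (X₁ ω -
      (μ[X₁ | MeasurableSpace.comap X₂ Real.measurableSpace]) ω) ^ 2 ∂μ) = variance X₁ μ := by
    rw [variance_eq_integral hX₁.aemeasurable, hmean₁]
    refine integral_congr_ae ?_
    filter_upwards [hcond] with ω hω
    simp [hω]
  have hvar₁ : 0 < variance X₁ μ := variance_pos_of_variance_comp_pos hL2₁ hvarf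
  have hvarX₂ : variance X₂ μ = variance (fun ω => f (X₁ ω)) μ + variance ε₂ μ := by
    rw [hX₂]
    exact IndepFun.variance_add hL2f hL2₂ (hindep.comp hf measurable_id)
  refine ⟨hmse, ?_, ?_⟩
  · rw [hmse, mul_div_mul_left _ _ hvar₁.ne']
  · rw [one_lt_div hvar₂, hvarX₂]
    linarith
end
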